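/- Let k be a field, d ≥ 5 an integer, S = k[x_1,…,x_d,y_1,…,y_d], and fix an integer a with 2 ≤ a ≤ d − 1. Let I(G_{d,a}) = x_1(y_1,…,y_d) + (x_i y_j : 2 ≤ i ≤ j ≤ a) + (x_i y_j : a+1 ≤ i ≤ j ≤ d). Then depth(S/(I(G_{d,a})^2 + (x_1 y_d))) ≥ min(a, d − a + 1). -/

import Mathlib

open MvPolynomial

/-- The maximal homogeneous ideal of the polynomial ring, generated by all variables. -/
noncomputable def maxHomIdeal (k : Type) [Field k] (V : Type) : Ideal (MvPolynomial V k) :=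
  Ideal.span (Set.range (X : V → MvPolynomial V k))

/-- `depthQuot k I` is the depth of `S/I` where `S = k[x_v : v ∈ V]`, defined as
`min {i : H^i_m(S/I) ≠ 0}` where `m` is the maximal homogeneous ideal and `H^i_m` is
local cohomology. -/
noncomputable def depthQuot (k : Type) [Field k] {V : Type} (I : Ideal (MvPolynomial V k)) : ℕ :=
  sInf {i : ℕ |
    Nontrivial ((localCohomology (maxHomIdeal k V) i).obj
      (ModuleCat.of (MvPolynomial V k) (MvPolynomial V k ⧸ I)))}

/-- The edge ideal of a simple graph `G`, generated by the monomials `x_i x_j` for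
edges `{i, j}` of `G`. -/
noncomputable def edgeIdeal (k : Type) [Field k] {V : Type} (G : SimpleGraph V) :
    Ideal (MvPolynomial V k) :=
  Ideal.span {p | ∃ i j, G.Adj i j ∧ p = X i * X j}

section Homological

open CategoryTheory Limits Opposite

variable {R : Type} [CommRing R]

/-- Every degree-`i` cocycle of the complex `Hom(K, M)` is a coboundary. -/
def CocyclesBound {C : Type*} [Category* C] [Preadditive C] (K : ChainComplex C ℕ) (M : C)
    (i : ℕ) : Prop :=
  ∀ f : K.X i ⟶ M, K.d (i + 1) i ≫ f = 0 → ∃ g : K.X (i - 1) ⟶ M, f = K.d i (i - 1) ≫ g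

lemma isZero_ext_of_cocyclesBound {A : ModuleCat.{0} R} (P : ProjectiveResolution A)
    (M : ModuleCat.{0} R) (i : ℕ) (h : CocyclesBound P.complex M i) :
    IsZero (((Ext R (ModuleCat.{0} R) i).obj (op A)).obj M) := by
  refine IsZero.of_iso ?_ (P.isoExt i M)
  rw [← HomologicalComplex.exactAt_iff_isZero_homology,
    HomologicalComplex.exactAt_iff' _ (i - 1) i (i + 1) (by cases i <;> simp) (by simp),
    ShortComplex.moduleCat_exact_iff]
  intro f hf
  obtain ⟨g, hg⟩ := h f hf
  exact ⟨g, hg.symm⟩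

lemma isZero_localCohomology (J : Ideal R) (M : ModuleCat.{0} R) (i : ℕ)
    (h : ∀ t : ℕ, IsZero (((Ext R (ModuleCat.{0} R) i).obj
      (op (ModuleCat.of R (R ⧸ J ^ t)))).obj M)) :
    IsZero ((localCohomology J i).obj M) := by
  let D := localCohomology.diagram (localCohomology.idealPowersDiagram J) i
  refine IsZero.of_iso ?_ (colimitObjIsoColimitCompEvaluation D M)
  rw [IsZero.iff_id_eq_zero]
  refine colimit.hom_ext fun j => ?_
  exact (h j.unop.unop).eq_of_src _ _

lemma exists_comp_eq_of_homologyι_comp_descOpcycles_eq_zero {C : Type*} [Category* C] [Abelian C]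
    (K : ChainComplex C ℕ) (i : ℕ) {I : C} [Injective I] (k : K.X i ⟶ I)
    (hk : K.d (i + 1) i ≫ k = 0)
    (h : K.homologyι i ≫ K.descOpcycles k (i + 1) (by simp) hk = 0) :
    ∃ g : K.X (i - 1) ⟶ I, K.d i (i - 1) ≫ g = k := by
  let S : ShortComplex C :=
    ShortComplex.mk _ _ (K.homologyι_comp_fromOpcycles i (i - 1))
  have hS : S.Exact := ShortComplex.exact_of_f_is_kernel _
    (K.homologyIsKernel i (i - 1) (by cases i <;> simp))
  refine ⟨hS.descToInjective (K.descOpcycles k (i + 1) (by simp) hk) h, ?_⟩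
  rw [← K.p_fromOpcycles, Category.assoc]
  exact (congrArg (K.pOpcycles i ≫ ·) (hS.comp_descToInjective _ h)).trans
    (K.p_descOpcycles _ _ _ _)

/-- The chain complex `Hom(K, M)`, regarded in the opposite category of modules. -/
noncomputable abbrev homOpComplex (K : ChainComplex (ModuleCat.{0} R) ℕ) (M : ModuleCat.{0} R) :
    ChainComplex (ModuleCat.{0} R)ᵒᵖ ℕ :=
  (((linearYoneda R (ModuleCat.{0} R)).obj M).rightOp.mapHomologicalComplex _).obj K

/-- A morphism `f : K.X i ⟶ M`, regarded as a morphism out of `R`. -/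
noncomputable def cochainHom (K : ChainComplex (ModuleCat.{0} R) ℕ) {M : ModuleCat.{0} R}
    {i : ℕ} (f : K.X i ⟶ M) : (homOpComplex K M).X i ⟶ op (ModuleCat.of R R) :=
  (ModuleCat.ofHom (LinearMap.toSpanSingleton R (K.X i ⟶ M) f)).op

lemma d_comp_cochainHom (K : ChainComplex (ModuleCat.{0} R) ℕ) {M : ModuleCat.{0} R}
    {i j : ℕ} (f : K.X i ⟶ M) :
    (homOpComplex K M).d j i ≫ cochainHom K f = cochainHom K (K.d j i ≫ f) := by
  apply Quiver.Hom.unop_inj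
  ext
  exact (congrArg (K.d j i ≫ ·) (one_smul R f)).trans (one_smul R (K.d j i ≫ f)).symm

lemma cochainHom_zero (K : ChainComplex (ModuleCat.{0} R) ℕ) {M : ModuleCat.{0} R} {i : ℕ} :
    cochainHom K (0 : K.X i ⟶ M) = 0 := by
  apply Quiver.Hom.unop_inj
  ext
  exact smul_zero (A := K.X i ⟶ M) (1 : R)

lemma map_comp_cochainHom {K L : ChainComplex (ModuleCat.{0} R) ℕ} (φ : K ⟶ L)
    {M : ModuleCat.{0} R} {i : ℕ} (f : L.X i ⟶ M) :
    ((((linearYoneda R (ModuleCat.{0} R)).obj M).rightOp.mapHomologicalComplex _).map φ).f i ≫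
      cochainHom L f = cochainHom K (φ.f i ≫ f) := by
  apply Quiver.Hom.unop_inj
  ext
  exact (congrArg (φ.f i ≫ ·) (one_smul R f)).trans (one_smul R (φ.f i ≫ f)).symm

/-- The morphism from the homology of `homOpComplex K M` induced by a cocycle `f : K.X i ⟶ M`. -/
noncomputable def cocycleClass (K : ChainComplex (ModuleCat.{0} R) ℕ) {M : ModuleCat.{0} R}
    {i : ℕ} (f : K.X i ⟶ M) (hf : K.d (i + 1) i ≫ f = 0) :
    (homOpComplex K M).homology i ⟶ op (ModuleCat.of R R) :=
  (homOpComplex K M).homologyι i ≫ (homOpComplex K M).descOpcycles (cochainHom K f) (i + 1)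
    (by simp) (by rw [d_comp_cochainHom, hf, cochainHom_zero])

lemma cocycleClass_naturality {K L : ChainComplex (ModuleCat.{0} R) ℕ} (φ : K ⟶ L)
    {M : ModuleCat.{0} R} {i : ℕ} (f : L.X i ⟶ M) (hf : L.d (i + 1) i ≫ f = 0) :
    HomologicalComplex.homologyMap
      ((((linearYoneda R (ModuleCat.{0} R)).obj M).rightOp.mapHomologicalComplex _).map φ) i ≫
        cocycleClass L f hf =
      cocycleClass K (φ.f i ≫ f) (by rw [← HomologicalComplex.Hom.comm_assoc, hf, comp_zero]) := by
  unfold cocycleClass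
  rw [HomologicalComplex.homologyι_naturality_assoc]
  congr 1
  rw [← cancel_epi (HomologicalComplex.pOpcycles _ i), HomologicalComplex.p_opcyclesMap_assoc,
    HomologicalComplex.p_descOpcycles, HomologicalComplex.p_descOpcycles, map_comp_cochainHom]

lemma exists_of_cocycleClass_eq_zero {K : ChainComplex (ModuleCat.{0} R) ℕ}
    {M : ModuleCat.{0} R} {i : ℕ} (f : K.X i ⟶ M) (hf : K.d (i + 1) i ≫ f = 0)
    (h : cocycleClass K f hf = 0) : ∃ g : K.X (i - 1) ⟶ M, f = K.d i (i - 1) ≫ g := by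
  obtain ⟨g, hg⟩ := exists_comp_eq_of_homologyι_comp_descOpcycles_eq_zero
    (homOpComplex K M) i (cochainHom K f) _ h
  refine ⟨g.unop.hom (1 : R), ?_⟩
  exact (one_smul R f).symm.trans (congrArg (fun q => q.unop.hom (1 : R)) hg).symm

/-- The projection `R/J^s ⟶ R/J^t` for `t ≤ s`. -/
noncomputable def powQuotMap (J : Ideal R) {t s : ℕ} (hst : t ≤ s) :
    ModuleCat.of R (R ⧸ J ^ s) ⟶ ModuleCat.of R (R ⧸ J ^ t) :=
  ModuleCat.ofHom (Submodule.mapQ _ _ LinearMap.id (Ideal.pow_le_pow_right hst))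

lemma dies_of_isZero_localCohomology (J : Ideal R) (M : ModuleCat.{0} R) (i : ℕ)
    (P : ∀ t : ℕ, ProjectiveResolution (ModuleCat.of R (R ⧸ J ^ t)))
    (h : IsZero ((localCohomology J i).obj M)) (t : ℕ) (f : (P t).complex.X i ⟶ M)
    (hf : (P t).complex.d (i + 1) i ≫ f = 0) :
    ∃ (s : ℕ) (hst : t ≤ s) (g : (P s).complex.X (i - 1) ⟶ M),
      (ProjectiveResolution.lift (powQuotMap J hst) (P s) (P t)).f i ≫ f =
        (P s).complex.d i (i - 1) ≫ g := by
  let D := localCohomology.diagram (localCohomology.idealPowersDiagram J) i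
  have h0 : IsZero (colimit (D ⋙ (evaluation _ _).obj M)) :=
    h.of_iso (colimitObjIsoColimitCompEvaluation D M).symm
  let F := ((linearYoneda R (ModuleCat.{0} R)).obj M).rightOp
  let e : ModuleCat.of R R ⟶ (D ⋙ (evaluation _ _).obj M).obj (op (op t)) :=
    (((P t).isoLeftDerivedObj F i).hom ≫ cocycleClass _ f hf).unop
  have he : (colimit.ι (D ⋙ (evaluation _ _).obj M) (op (op t))).hom (e.hom 1) = 0 := by
    have : e ≫ colimit.ι (D ⋙ (evaluation _ _).obj M) (op (op t)) = 0 := h0.eq_of_tgt _ _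
    exact congrArg (fun q => q.hom (1 : R)) this
  obtain ⟨s', w, hs⟩ := Concrete.colimit_rep_eq_zero R
    (D ⋙ (evaluation _ _).obj M) (op (op t)) (e.hom 1) he
  obtain ⟨⟨s⟩⟩ := s'
  have hst : t ≤ s := leOfHom w.unop.unop
  refine ⟨s, hst, exists_of_cocycleClass_eq_zero _
    (by rw [← HomologicalComplex.Hom.comm_assoc, hf, comp_zero]) ?_⟩
  rw [← cocycleClass_naturality _ f hf]
  refine (cancel_epi ((P s).isoLeftDerivedObj F i).hom).mp (Eq.trans ?_ comp_zero.symm)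
  refine (ProjectiveResolution.isoLeftDerivedObj_hom_naturality_assoc (powQuotMap J hst)
    (P s) (P t) _ (ProjectiveResolution.lift_commutes_zero _ (P s) (P t)) F i
    (cocycleClass _ f hf)).symm.trans ?_
  refine Quiver.Hom.unop_inj (ModuleCat.hom_ext (LinearMap.ext_ring ?_))
  exact hs

end Homological

section Cocycles

open CategoryTheory Limits Opposite

variable {C : Type*} [Category* C] [Abelian C]

lemma CocyclesBound.of_shortExact {K : ChainComplex C ℕ} [∀ n, Projective (K.X n)]
    {S : ShortComplex C} (hS : S.ShortExact) {i : ℕ} (h₁ : CocyclesBound K S.X₁ i)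
    (h₃ : CocyclesBound K S.X₃ i) : CocyclesBound K S.X₂ i := by
  have := hS.mono_f
  have := hS.epi_g
  intro f hf
  obtain ⟨g'', hg''⟩ := h₃ (f ≫ S.g) (by rw [← Category.assoc, hf, zero_comp])
  let g := Projective.factorThru g'' S.g
  have hg : g ≫ S.g = g'' := Projective.factorThru_comp _ _
  let l := hS.exact.lift (f - K.d i (i - 1) ≫ g) (by simp [hg, hg''])
  have hl : l ≫ S.f = f - K.d i (i - 1) ≫ g := hS.exact.lift_f _ _
  obtain ⟨g', hg'⟩ := h₁ l (by
    rw [← cancel_mono S.f, Category.assoc, hl]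
    simp [hf])
  refine ⟨g + g' ≫ S.f, ?_⟩
  rw [Preadditive.comp_add, ← Category.assoc, ← hg', hl]
  abel

variable {R : Type*} [CommRing R] [Linear R C]

/-- If `r` is regular on `M` with cokernel `N`, then multiplication by `r` is injective on
cocycles modulo coboundaries. -/
lemma exists_of_smul_coboundary {K : ChainComplex C ℕ} [∀ n, Projective (K.X n)]
    {r : R} {M N : C} {q : M ⟶ N} {w : (r • 𝟙 M) ≫ q = 0}
    (hS : (ShortComplex.mk (r • 𝟙 M) q w).ShortExact) {i : ℕ}
    (h : i ≠ 0 → CocyclesBound K N (i - 1)) (f : K.X i ⟶ M)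
    (hf : ∃ g, r • f = K.d i (i - 1) ≫ g) : ∃ g, f = K.d i (i - 1) ≫ g := by
  have : Mono (r • 𝟙 M) := hS.mono_f
  have : Epi q := hS.epi_g
  obtain ⟨g, hg⟩ := hf
  rcases i with _ | i
  · refine ⟨0, ?_⟩
    rw [← cancel_mono (r • 𝟙 M)]
    simpa using hg
  · change K.X i ⟶ M at g
    change r • f = K.d (i + 1) i ≫ g at hg
    have w' : (K.d (i + 1) i ≫ g) ≫ q = 0 := by
      rw [← hg]
      simpa using congrArg (f ≫ ·) w
    obtain ⟨h', hh'⟩ := h (by simp) (g ≫ q) (by simpa using w')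
    change K.X (i - 1) ⟶ N at h'
    change g ≫ q = K.d i (i - 1) ≫ h' at hh'
    let h'' := Projective.factorThru h' q
    have hh'' : h'' ≫ q = h' := Projective.factorThru_comp _ _
    let l := hS.exact.lift (g - K.d i (i - 1) ≫ h'') (by simp [hh'', hh'])
    have hl : l ≫ (r • 𝟙 M) = g - K.d i (i - 1) ≫ h'' := hS.exact.lift_f _ _
    refine ⟨l, ?_⟩
    change f = K.d (i + 1) i ≫ l
    rw [← cancel_mono (r • 𝟙 M), Category.assoc, hl]
    simpa using hg

lemma CocyclesBound.of_regular {A : C} (P : ProjectiveResolution A) {r : R} {t : ℕ}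
    (hA : r ^ t • 𝟙 A = 0) {M N : C} {q : M ⟶ N} {w : (r • 𝟙 M) ≫ q = 0}
    (hS : (ShortComplex.mk (r • 𝟙 M) q w).ShortExact) {i : ℕ}
    (h : i ≠ 0 → CocyclesBound P.complex N (i - 1)) : CocyclesBound P.complex M i := by
  intro f hf
  have key : ∀ n : ℕ, (∃ g, r ^ n • f = P.complex.d i (i - 1) ≫ g) →
      ∃ g, f = P.complex.d i (i - 1) ≫ g := by
    intro n
    induction n with
    | zero => simp
    | succ n ih =>
      intro hn
      refine ih (exists_of_smul_coboundary hS h _ ?_)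
      rwa [smul_smul, ← pow_succ']
  refine key t ?_
  let H : Homotopy (r ^ t • 𝟙 P.complex) 0 := ProjectiveResolution.liftHomotopyZero _ (by
    ext
    simp only [HomologicalComplex.smul_f_apply, Linear.smul_comp, Category.id_comp,
      HomologicalComplex.zero_f]
    rw [← Category.comp_id (P.π.f 0), ← Linear.comp_smul]
    exact (congrArg (P.π.f 0 ≫ ·) hA).trans comp_zero)
  have hc := H.comm i
  rcases i with _ | i
  · refine ⟨0, ?_⟩
    simp only [Homotopy.dNext_zero_chainComplex, Homotopy.prevD_chainComplex] at hc
    have := congrArg (· ≫ f) hc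
    simpa [hf] using this
  · rw [Homotopy.dNext_succ_chainComplex, Homotopy.prevD_chainComplex] at hc
    refine ⟨H.hom i (i + 1) ≫ f, ?_⟩
    have := congrArg (· ≫ f) hc
    simpa [hf] using this

/-- The augmentation `P₀ ⟶ A` of a projective resolution. -/
noncomputable def augmentation {A : C} (P : ProjectiveResolution A) : P.complex.X 0 ⟶ A :=
  P.π.f 0

lemma epi_augmentation {A : C} (P : ProjectiveResolution A) : Epi (augmentation P) :=
  inferInstanceAs (Epi (P.π.f 0))

lemma d_comp_augmentation {A : C} (P : ProjectiveResolution A) :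
    P.complex.d 1 0 ≫ augmentation P = 0 :=
  P.complex_d_comp_π_f_zero

/-- Every degree-`i` cocycle of one of the complexes `Hom(P t, M)` becomes a coboundary after
pulling it back to some `Hom(P s, M)` along a lift of `p t s`. -/
def CocyclesDie {A : ℕ → C} (P : ∀ t, ProjectiveResolution (A t))
    (p : ∀ t s : ℕ, t ≤ s → (A s ⟶ A t)) (M : C) (i : ℕ) : Prop :=
  ∀ (t : ℕ) (f : (P t).complex.X i ⟶ M), (P t).complex.d (i + 1) i ≫ f = 0 →
    ∃ (s : ℕ) (hst : t ≤ s) (g : (P s).complex.X (i - 1) ⟶ M)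
      (φ : (P s).complex ⟶ (P t).complex),
      φ.f 0 ≫ augmentation (P t) = augmentation (P s) ≫ p t s hst ∧
        φ.f i ≫ f = (P s).complex.d i (i - 1) ≫ g

lemma CocyclesDie.of_regular {A : ℕ → C} (P : ∀ t, ProjectiveResolution (A t))
    (p : ∀ t s : ℕ, t ≤ s → (A s ⟶ A t))
    (hp : ∀ {t s u : ℕ} (h : t ≤ s) (h' : s ≤ u), p s u h' ≫ p t s h = p t u (h.trans h'))
    {r : R} {M N : C} {q : M ⟶ N} {w : (r • 𝟙 M) ≫ q = 0}
    (hS : (ShortComplex.mk (r • 𝟙 M) q w).ShortExact) {i : ℕ}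
    (h₀ : CocyclesDie P p M i) (h₁ : CocyclesDie P p M (i + 1)) : CocyclesDie P p N i := by
  have : Mono (r • 𝟙 M) := hS.mono_f
  have : Epi q := hS.epi_g
  intro t f hf
  obtain ⟨f', rfl⟩ : ∃ f', f' ≫ q = f := ⟨_, Projective.factorThru_comp f q⟩
  obtain ⟨h, hh⟩ : ∃ h : (P t).complex.X (i + 1) ⟶ M,
      h ≫ (r • 𝟙 M) = (P t).complex.d (i + 1) i ≫ f' :=
    ⟨_, hS.exact.lift_f ((P t).complex.d (i + 1) i ≫ f') (by rwa [Category.assoc])⟩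
  obtain ⟨s, hst, g, φ, hφ, hg⟩ := h₁ t h (by
    rw [← cancel_mono (r • 𝟙 M), Category.assoc, hh]
    simp)
  change (P s).complex.X i ⟶ M at g
  change φ.f (i + 1) ≫ h = (P s).complex.d (i + 1) i ≫ g at hg
  obtain ⟨u, hsu, g', ψ, hψ, hg'⟩ := h₀ s (φ.f i ≫ f' - g ≫ (r • 𝟙 M)) (by
    rw [Preadditive.comp_sub, ← Category.assoc _ g, ← hg, Category.assoc, hh,
      ← Category.assoc, ← φ.comm, Category.assoc, sub_self])
  refine ⟨u, hst.trans hsu, g' ≫ q, ψ ≫ φ, ?_, ?_⟩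
  · rw [HomologicalComplex.comp_f, Category.assoc, hφ, ← Category.assoc, hψ, Category.assoc,
      hp hst hsu]
  · rw [HomologicalComplex.comp_f, ← Category.assoc _ g', ← hg', Category.assoc,
      Category.assoc, Preadditive.sub_comp, Category.assoc, Category.assoc, w, Limits.comp_zero,
      sub_zero]

end Cocycles

section Ideals

open CategoryTheory

variable {R : Type} [CommRing R]

/-- For all `i < n` and all `t`, the cohomology of `Hom(P, R/J)` vanishes in degree `i` for every
projective resolution `P` of `R/𝔪^t`. -/
def ExtVanishBelow (𝔪 J : Ideal R) (n : ℕ) : Prop :=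
  ∀ i < n, ∀ (t : ℕ) (P : ProjectiveResolution (ModuleCat.of R (R ⧸ 𝔪 ^ t))),
    CocyclesBound P.complex (ModuleCat.of R (R ⧸ J)) i

lemma ExtVanishBelow.isZero_localCohomology {𝔪 J : Ideal R} {n : ℕ} (h : ExtVanishBelow 𝔪 J n)
    {i : ℕ} (hi : i < n) :
    Limits.IsZero ((localCohomology 𝔪 i).obj (ModuleCat.of R (R ⧸ J))) :=
  _root_.isZero_localCohomology 𝔪 _ i fun t =>
    isZero_ext_of_cocyclesBound (projectiveResolution _) _ i (h i hi t _)

/-- The projection `R/J ⟶ R/(J + (r))`. -/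
noncomputable def quotSupMap (J : Ideal R) (r : R) :
    ModuleCat.of R (R ⧸ J) ⟶ ModuleCat.of R (R ⧸ (J ⊔ Ideal.span {r})) :=
  ModuleCat.ofHom (Submodule.mapQ _ _ LinearMap.id (le_sup_left : J ≤ J ⊔ Ideal.span {r}))

lemma ExtVanishBelow.of_colon_of_sup {𝔪 J J₁ : Ideal R} {n : ℕ} (r : R)
    (hJ₁ : ∀ p, p ∈ J₁ ↔ r * p ∈ J) (h₁ : ExtVanishBelow 𝔪 J₁ n)
    (h₂ : ExtVanishBelow 𝔪 (J ⊔ Ideal.span {r}) n) : ExtVanishBelow 𝔪 J n := by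
  intro i hi t P
  let f : (R ⧸ J₁) →ₗ[R] (R ⧸ J) :=
    Submodule.mapQ J₁ J (LinearMap.mulLeft R r) fun p hp => (hJ₁ p).1 hp
  have w : ModuleCat.ofHom f ≫ quotSupMap J r = 0 := by
    ext
    refine (Submodule.Quotient.mk_eq_zero _).2 ?_
    exact Ideal.mem_sup_right (Ideal.mul_mem_right _ _ (Ideal.mem_span_singleton_self r))
  let T : ShortComplex (ModuleCat.{0} R) := ShortComplex.mk _ _ w
  have hT : T.ShortExact := by
    refine { exact := ?_, mono_f := ?_, epi_g := ?_ }
    · rw [ShortComplex.moduleCat_exact_iff]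
      intro x hx
      obtain ⟨p, rfl⟩ := Submodule.Quotient.mk_surjective J x
      have hp : p ∈ J ⊔ Ideal.span {r} := (Submodule.Quotient.mk_eq_zero _).1 hx
      obtain ⟨j, hj, b, hb, rfl⟩ := Submodule.mem_sup.1 hp
      obtain ⟨c, rfl⟩ := Ideal.mem_span_singleton'.1 hb
      refine ⟨Submodule.Quotient.mk c, (Submodule.Quotient.eq J).2 ?_⟩
      simpa [mul_comm r c] using hj
    · refine (ModuleCat.mono_iff_injective _).2 ((injective_iff_map_eq_zero f).2 fun x hx => ?_)
      obtain ⟨p, rfl⟩ := Submodule.Quotient.mk_surjective J₁ x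
      exact (Submodule.Quotient.mk_eq_zero _).2
        ((hJ₁ p).2 ((Submodule.Quotient.mk_eq_zero _).1 hx))
    · refine (ModuleCat.epi_iff_surjective _).2 fun x => ?_
      obtain ⟨p, rfl⟩ := Submodule.Quotient.mk_surjective _ x
      exact ⟨Submodule.Quotient.mk p, rfl⟩
  have := fun n => P.projective n
  exact CocyclesBound.of_shortExact hT (h₁ i hi t P) (h₂ i hi t P)

lemma smul_comp_quotSupMap (J : Ideal R) (r : R) :
    (r • 𝟙 (ModuleCat.of R (R ⧸ J))) ≫ quotSupMap J r = 0 := by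
  ext
  refine (Submodule.Quotient.mk_eq_zero _).2 ?_
  exact Ideal.mem_sup_right (Ideal.mul_mem_right _ _ (Ideal.mem_span_singleton_self r))

lemma shortExact_quotSupMap {J : Ideal R} {r : R} (hr : ∀ p, r * p ∈ J → p ∈ J) :
    (ShortComplex.mk _ _ (smul_comp_quotSupMap J r)).ShortExact := by
  refine { exact := ?_, mono_f := ?_, epi_g := ?_ }
  · rw [ShortComplex.moduleCat_exact_iff]
    intro x hx
    obtain ⟨p, rfl⟩ := Submodule.Quotient.mk_surjective J x
    have hp : p ∈ J ⊔ Ideal.span {r} := (Submodule.Quotient.mk_eq_zero _).1 hx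
    obtain ⟨j, hj, b, hb, rfl⟩ := Submodule.mem_sup.1 hp
    obtain ⟨c, rfl⟩ := Ideal.mem_span_singleton'.1 hb
    refine ⟨Submodule.Quotient.mk c, (Submodule.Quotient.eq J).2 ?_⟩
    simpa [mul_comm r c] using hj
  · refine (ModuleCat.mono_iff_injective _).2 ((injective_iff_map_eq_zero
      (r • 𝟙 (ModuleCat.of R (R ⧸ J))).hom).2 fun x hx => ?_)
    obtain ⟨p, rfl⟩ := Submodule.Quotient.mk_surjective J x
    exact (Submodule.Quotient.mk_eq_zero _).2 (hr p ((Submodule.Quotient.mk_eq_zero _).1 hx))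
  · refine (ModuleCat.epi_iff_surjective _).2 fun x => ?_
    obtain ⟨p, rfl⟩ := Submodule.Quotient.mk_surjective _ x
    exact ⟨Submodule.Quotient.mk p, rfl⟩

lemma ExtVanishBelow.of_regular {𝔪 J : Ideal R} {n : ℕ} {r : R} (hr𝔪 : r ∈ 𝔪)
    (hr : ∀ p, r * p ∈ J → p ∈ J) (h : ExtVanishBelow 𝔪 (J ⊔ Ideal.span {r}) n) :
    ExtVanishBelow 𝔪 J (n + 1) := by
  intro i hi t P
  refine CocyclesBound.of_regular (R := R) P (r := r) (t := t) ?_ (shortExact_quotSupMap hr)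
    fun hi0 => h (i - 1) (by omega) t P
  ext
  exact (Submodule.Quotient.mk_eq_zero _).2
    (Ideal.mul_mem_right _ _ (Ideal.pow_mem_pow hr𝔪 t))

lemma extVanishBelow_zero (𝔪 J : Ideal R) : ExtVanishBelow 𝔪 J 0 :=
  fun _ hi => absurd hi (Nat.not_lt_zero _)

lemma powQuotMap_comp (J : Ideal R) {t s u : ℕ} (h : t ≤ s) (h' : s ≤ u) :
    powQuotMap J h' ≫ powQuotMap J h = powQuotMap J (h.trans h') := by
  ext
  rfl

lemma exists_not_cocyclesDie [IsNoetherianRing R] {𝔪 : Ideal R} (hm : 𝔪.IsMaximal)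
    (P : ∀ t : ℕ, ProjectiveResolution (ModuleCat.of R (R ⧸ 𝔪 ^ t))) (J : Ideal R)
    (hJ : J ≤ 𝔪) :
    ∃ i, ¬ CocyclesDie P (fun _ _ h => powQuotMap 𝔪 h) (ModuleCat.of R (R ⧸ J)) i := by
  induction J using WellFoundedGT.induction with
  | _ J ih =>
    by_cases hreg : ∃ r ∈ 𝔪, ∀ p, r * p ∈ J → p ∈ J
    · obtain ⟨r, hrm, hr⟩ := hreg
      have hlt : J < J ⊔ Ideal.span {r} := by
        refine lt_of_le_of_ne le_sup_left fun h => hm.ne_top ?_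
        have hrJ : r ∈ J := by
          rw [h]
          exact Ideal.mem_sup_right (Ideal.mem_span_singleton_self r)
        exact (Ideal.eq_top_iff_one 𝔪).2 (hJ (hr 1 (by simpa using hrJ)))
      obtain ⟨i, hi⟩ := ih _ hlt (sup_le hJ ((Ideal.span_singleton_le_iff_mem _).2 hrm))
      by_contra! hdie
      exact hi (CocyclesDie.of_regular (R := R) (r := r) P _ (powQuotMap_comp 𝔪)
        (shortExact_quotSupMap hr) (hdie i) (hdie (i + 1)))
    · have hns : ¬ Subsingleton ((R ⧸ 𝔪) →ₗ[R] (R ⧸ J)) := by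
        rw [IsSMulRegular.subsingleton_linearMap_iff]
        rintro ⟨r, hr, hr'⟩
        rw [Ideal.annihilator_quotient] at hr
        refine hreg ⟨r, hr, fun p hp => ?_⟩
        refine (Submodule.Quotient.mk_eq_zero _).1 (hr' ?_ : (Submodule.Quotient.mk p : R ⧸ J) = 0)
        change r • (Submodule.Quotient.mk p : R ⧸ J) = r • 0
        rw [smul_zero]
        exact (Submodule.Quotient.mk_eq_zero _).2 hp
      rw [not_subsingleton_iff_nontrivial] at hns
      obtain ⟨e, he⟩ := exists_ne (0 : (R ⧸ 𝔪) →ₗ[R] (R ⧸ J))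
      refine ⟨0, fun hdie => he ?_⟩
      let e' : ModuleCat.of R (R ⧸ 𝔪 ^ 1) ⟶ ModuleCat.of R (R ⧸ J) :=
        ModuleCat.ofHom (e ∘ₗ Submodule.mapQ _ _ LinearMap.id (pow_one 𝔪).le)
      obtain ⟨s, hst, g, φ, hφ, hg⟩ := hdie 1 (augmentation (P 1) ≫ e') (by
        rw [← Category.assoc]
        exact (congrArg (· ≫ e') (d_comp_augmentation (P 1))).trans Limits.zero_comp)
      have h0 : augmentation (P s) ≫ powQuotMap 𝔪 hst ≫ e' = 0 := by
        rw [← Category.assoc, ← hφ, Category.assoc, hg]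
        simp
      have hepi : Epi (augmentation (P s)) := epi_augmentation _
      have h1 : powQuotMap 𝔪 hst ≫ e' = 0 :=
        (cancel_epi (augmentation (P s))).1 (h0.trans Limits.comp_zero.symm)
      ext
      exact congrArg (fun q => q.hom (Submodule.Quotient.mk (1 : R))) h1

lemma exists_nontrivial_localCohomology [IsNoetherianRing R] {𝔪 : Ideal R} (hm : 𝔪.IsMaximal)
    (J : Ideal R) (hJ : J ≤ 𝔪) :
    ∃ i, Nontrivial ((localCohomology 𝔪 i).obj (ModuleCat.of R (R ⧸ J))) := by
  let P : ∀ t : ℕ, ProjectiveResolution (ModuleCat.of R (R ⧸ 𝔪 ^ t)) :=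
    fun t => projectiveResolution _
  obtain ⟨i, hi⟩ := exists_not_cocyclesDie hm P J hJ
  refine ⟨i, not_subsingleton_iff_nontrivial.1 fun h => hi fun t f hf => ?_⟩
  obtain ⟨s, hst, g, hg⟩ := dies_of_isZero_localCohomology 𝔪 _ i P
    (ModuleCat.isZero_of_subsingleton _) t f hf
  exact ⟨s, hst, g, _, ProjectiveResolution.lift_commutes_zero _ _ _, hg⟩

end Ideals

section Monomial

variable {k : Type} [Field k] {V : Type}

/-- The ideal spanned by the monomials whose exponents satisfy `Q`. -/
noncomputable def monIdeal (k : Type) [Field k] {V : Type} (Q : (V →₀ ℕ) → Prop) :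
    Ideal (MvPolynomial V k) :=
  Ideal.span ((fun m => monomial m 1) '' {m | Q m})

lemma mem_monIdeal {Q : (V →₀ ℕ) → Prop} (hQ : Monotone Q) {p : MvPolynomial V k} :
    p ∈ monIdeal k Q ↔ ∀ m ∈ p.support, Q m := by
  rw [monIdeal, mem_ideal_span_monomial_image]
  refine forall₂_congr fun m _ => ⟨?_, fun h => ⟨m, h, le_rfl⟩⟩
  rintro ⟨n, hn, hnm⟩
  exact hQ hnm hn

lemma monomial_mem_monIdeal {Q : (V →₀ ℕ) → Prop} {m : V →₀ ℕ} (h : Q m) :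
    monomial m (1 : k) ∈ monIdeal k Q :=
  Ideal.subset_span ⟨m, h, rfl⟩

lemma X_mul_mem_monIdeal {Q : (V →₀ ℕ) → Prop} (hQ : Monotone Q) (v : V)
    (p : MvPolynomial V k) :
    X v * p ∈ monIdeal k Q ↔ ∀ m ∈ p.support, Q (m + Finsupp.single v 1) := by
  rw [mem_monIdeal hQ, support_X_mul]
  simp [add_comm]

lemma monIdeal_or (Q : (V →₀ ℕ) → Prop) (v : V) :
    monIdeal k (fun m => m v ≠ 0 ∨ Q m) = monIdeal k Q ⊔ Ideal.span {X v} := by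
  apply le_antisymm
  · refine Ideal.span_le.2 ?_
    rintro _ ⟨m, hv | hm, rfl⟩
    · refine Ideal.mem_sup_right (Ideal.mem_span_singleton.2 ?_)
      exact (X_dvd_monomial).2 (Or.inr hv)
    · exact Ideal.mem_sup_left (monomial_mem_monIdeal hm)
  · refine sup_le (Ideal.span_mono (Set.image_mono fun m hm => Or.inr hm)) ?_
    rw [Ideal.span_singleton_le_iff_mem]
    exact monomial_mem_monIdeal (Or.inl (by simp))

lemma X_mem_maxHomIdeal (v : V) : (X v : MvPolynomial V k) ∈ maxHomIdeal k V :=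
  Ideal.subset_span ⟨v, rfl⟩

lemma extVanishBelow_monIdeal_card [DecidableEq V] (F : Finset V) :
    ∀ {Q : (V →₀ ℕ) → Prop}, Monotone Q →
      (∀ f ∈ F, ∀ m, Q (m + Finsupp.single f 1) → Q m) →
      ExtVanishBelow (maxHomIdeal k V) (monIdeal k Q) F.card := by
  induction F using Finset.induction_on with
  | empty => exact fun _ _ => extVanishBelow_zero _ _
  | insert f F hf ih =>
    intro Q hQ h
    rw [Finset.card_insert_of_notMem hf]
    refine ExtVanishBelow.of_regular (X_mem_maxHomIdeal f) (fun p hp => ?_) ?_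
    · rw [X_mul_mem_monIdeal hQ] at hp
      exact (mem_monIdeal hQ).2 fun m hm => h f (Finset.mem_insert_self _ _) m (hp m hm)
    · rw [← monIdeal_or]
      refine ih (fun m n hmn => ?_) fun g hg m => ?_
      · exact Or.imp (fun h h' => h (Nat.le_zero.1 (h' ▸ hmn f))) (hQ hmn)
      · refine Or.imp (fun h' => ?_) (h g (Finset.mem_insert_of_mem hg) m)
        have : g ≠ f := fun h => hf (h ▸ hg)
        simpa [Finsupp.single_apply, this] using h'

/-- Exponents of monomials that are divisible by a variable in `D`, or whose product with the
monomial of exponent `u` satisfies `P`. -/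
def NodePred (P : (V →₀ ℕ) → Prop) (D : Set V) (u m : V →₀ ℕ) : Prop :=
  (∃ v ∈ D, m v ≠ 0) ∨ P (m + u)

lemma NodePred.monotone {P : (V →₀ ℕ) → Prop} (hP : Monotone P) (D : Set V) (u : V →₀ ℕ) :
    Monotone (NodePred P D u) := by
  intro m n hmn
  refine Or.imp ?_ (hP (by gcongr))
  rintro ⟨v, hv, h⟩
  exact ⟨v, hv, fun h' => h (Nat.le_zero.1 (h' ▸ hmn v))⟩

lemma extVanishBelow_node_of_split {P : (V →₀ ℕ) → Prop} (hP : Monotone P) {D : Set V}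
    {u : V →₀ ℕ} {n : ℕ} (v : V)
    (h₁ : ExtVanishBelow (maxHomIdeal k V)
      (monIdeal k (NodePred P D (u + Finsupp.single v 1))) n)
    (h₂ : ExtVanishBelow (maxHomIdeal k V) (monIdeal k (NodePred P (insert v D) u)) n) :
    ExtVanishBelow (maxHomIdeal k V) (monIdeal k (NodePred P D u)) n := by
  by_cases hv : v ∈ D
  · rwa [Set.insert_eq_of_mem hv] at h₂
  refine ExtVanishBelow.of_colon_of_sup (X v) (fun p => ?_) h₁ ?_
  · rw [X_mul_mem_monIdeal (NodePred.monotone hP D u), mem_monIdeal (NodePred.monotone hP D _)]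
    refine forall₂_congr fun m _ => or_congr (exists_congr fun w => and_congr_right fun hw => ?_) ?_
    · have : v ≠ w := fun h => hv (h ▸ hw)
      simp [this]
    · rw [add_assoc, add_comm u]
  · rw [← monIdeal_or]
    convert h₂ using 3
    simp [NodePred, or_assoc]

lemma extVanishBelow_node_of_injOn {P : (V →₀ ℕ) → Prop} (hP : Monotone P) {D : Set V}
    {u : V →₀ ℕ} {n : ℕ} (φ : ℕ → V) (hφ : Set.InjOn φ (Set.Iio n))
    (hD : ∀ i < n, φ i ∉ D)
    (h : ∀ i < n, ∀ m : V →₀ ℕ, (∀ v ∈ D, m v = 0) →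
      P (m + u + Finsupp.single (φ i) 1) → P (m + u)) :
    ExtVanishBelow (maxHomIdeal k V) (monIdeal k (NodePred P D u)) n := by
  classical
  have hcard : ((Finset.range n).image φ).card = n := by
    rw [Finset.card_image_of_injOn (by simpa [Set.Iio] using hφ), Finset.card_range]
  rw [← hcard]
  refine extVanishBelow_monIdeal_card _ (NodePred.monotone hP D u) fun f hf m hm => ?_
  obtain ⟨i, hi, rfl⟩ := Finset.mem_image.1 hf
  rw [Finset.mem_range] at hi
  by_cases hmD : ∀ v ∈ D, m v = 0
  · refine Or.inr (h i hi m hmD ?_)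
    rcases hm with ⟨v, hv, hmv⟩ | hm
    · have : φ i ≠ v := fun h => hD i hi (h ▸ hv)
      exact absurd (by simpa [Finsupp.single_apply, this] using hmD v hv) hmv
    · rwa [add_right_comm]
  · push Not at hmD
    exact Or.inl hmD

lemma maxHomIdeal_eq_ker : maxHomIdeal k V = RingHom.ker (constantCoeff (R := k) (σ := V)) := by
  rw [maxHomIdeal]
  ext p
  rw [RingHom.mem_ker, show (Set.range X : Set (MvPolynomial V k)) = X '' Set.univ by simp,
    mem_ideal_span_X_image]
  simp only [Set.mem_univ, true_and]
  constructor
  · intro h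
    by_contra h0
    obtain ⟨i, hi⟩ := h 0 (by simpa [mem_support_iff, constantCoeff_eq] using h0)
    exact hi rfl
  · intro h m hm
    by_contra! hm0
    have : m = 0 := Finsupp.ext hm0
    subst this
    exact (mem_support_iff.1 hm) h

lemma maxHomIdeal_isMaximal : (maxHomIdeal k V).IsMaximal := by
  rw [maxHomIdeal_eq_ker]
  exact RingHom.ker_isMaximal_of_surjective _ fun c => ⟨C c, constantCoeff_C V c⟩

lemma le_depthQuot [Finite V] {I : Ideal (MvPolynomial V k)} {n : ℕ} (hI : I ≤ maxHomIdeal k V)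
    (h : ExtVanishBelow (maxHomIdeal k V) I n) : n ≤ depthQuot k I := by
  refine le_csInf (exists_nontrivial_localCohomology maxHomIdeal_isMaximal I hI) fun i hi => ?_
  by_contra! hlt
  exact not_subsingleton_iff_nontrivial.2 hi
    (ModuleCat.subsingleton_of_isZero (h.isZero_localCohomology hlt))

end Monomial

section Combinatorics

/-- `{i, k}`, as a multiset, is contained in the multiset with multiplicities `f`. -/
def PairLE (f : ℕ → ℕ) (i k : ℕ) : Prop :=
  1 ≤ f i ∧ 1 ≤ f k ∧ (i = k → 2 ≤ f i)

/-- `x_i y_j` is an edge of `G_{d,a}` (with indices starting at `0`). -/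
def IsEdge (a i j : ℕ) : Prop :=
  i = 0 ∨ (1 ≤ i ∧ i ≤ j ∧ j < a) ∨ (a ≤ i ∧ i ≤ j)

/-- The monomial with exponents `A` in the `x`-variables and `B` in the `y`-variables is divisible
by `x_0 y_{d-1}` or by the product of two edges of `G_{d,a}`. -/
def SquareOrEdge (d a : ℕ) (A B : ℕ → ℕ) : Prop :=
  (1 ≤ A 0 ∧ 1 ≤ B (d - 1)) ∨
    ∃ i j k l, j < d ∧ l < d ∧ IsEdge a i j ∧ IsEdge a k l ∧ PairLE A i k ∧ PairLE B j l

lemma PairLE.congr {f g : ℕ → ℕ} {i k : ℕ} (h : PairLE f i k) (hi : f i = g i)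
    (hk : f k = g k) : PairLE g i k := by
  unfold PairLE at *
  rwa [← hi, ← hk]

variable {d a : ℕ} {A B A' B' : ℕ → ℕ}

lemma exists_edge_ne_zero {i j k l : ℕ} (hA0 : A 0 ≤ 1) (hj : j < d) (hl : l < d)
    (hij : IsEdge a i j) (hkl : IsEdge a k l) (hA : PairLE A i k) (hB : PairLE B j l) :
    ∃ p q, 1 ≤ p ∧ q < d ∧ (p ≤ q ∧ q < a ∨ a ≤ p ∧ p ≤ q) ∧ 1 ≤ A p ∧ 1 ≤ B q := by
  unfold IsEdge PairLE at *
  by_cases hk : k = 0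
  · exact ⟨i, j, by grind⟩
  · exact ⟨k, l, by grind⟩

lemma SquareOrEdge.of_two_x (hA0 : 2 ≤ A 0) (hB : ∀ q, B' q = B q)
    (h : SquareOrEdge d a A' B') : SquareOrEdge d a A B := by
  rcases h with h | ⟨i, j, k, l, hj, hl, -, -, -, h⟩
  · exact Or.inl ⟨by omega, hB _ ▸ h.2⟩
  · refine Or.inr ⟨0, j, 0, l, hj, hl, Or.inl rfl, Or.inl rfl, ?_, ?_⟩
    · unfold PairLE at *; grind
    · unfold PairLE at *; grind

lemma SquareOrEdge.of_xyy {c : ℕ} (had : a < d) (hc : c < a) (hA0 : A 0 = 1) (hB0 : 1 ≤ B 0)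
    (hBc : 1 ≤ B c) (hBz : ∀ j, c < j → j < a → B j = 0)
    (hA : ∀ q, q ≤ c ∨ a ≤ q → A' q = A q) (hB : ∀ q, c < q → B' q = B q)
    (h : SquareOrEdge d a A' B') : SquareOrEdge d a A B := by
  rcases h with h | ⟨i, j, k, l, hj, hl, h1, h2, h3, h4⟩
  · exact Or.inl (by grind)
  · obtain ⟨p, q, hp, hq, hpq, hAp, hBq⟩ := exists_edge_ne_zero (by grind) hj hl h1 h2 h3 h4
    unfold SquareOrEdge IsEdge PairLE
    rcases hpq with hpq | hpq
    · exact Or.inr ⟨p, c, 0, 0, by grind⟩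
    · exact Or.inr ⟨p, q, 0, 0, by grind⟩

lemma SquareOrEdge.of_xyx {c i : ℕ} (had : a < d) (hc : c < a) (hi : 1 ≤ i) (hic : i ≤ c)
    (hA0 : 1 ≤ A 0) (hAi : 1 ≤ A i) (hBc : 1 ≤ B c)
    (hB : ∀ q, B' q = B q) (h : SquareOrEdge d a A' B') : SquareOrEdge d a A B := by
  rcases h with h | ⟨i', j, k, l, hj, hl, -, -, -, h4⟩
  · exact Or.inl (by grind)
  · unfold SquareOrEdge IsEdge PairLE at *
    by_cases hjc : j = c
    · exact Or.inr ⟨0, l, i, c, by grind⟩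
    · exact Or.inr ⟨0, j, i, c, by grind⟩

lemma SquareOrEdge.of_xy {c : ℕ} (had : a < d) (hc : c < a) (hc1 : 1 ≤ c) (hA0 : A 0 = 1)
    (hBc : 1 ≤ B c) (hBz : ∀ j, c < j → j < a → B j = 0)
    (hAz : ∀ j, 1 ≤ j → j ≤ c → A j = 0)
    (hA : ∀ q, q ≤ c ∨ (a ≤ q ∧ q < d - 1) → A' q = A q) (hB : ∀ q, c < q → B' q = B q)
    (h : SquareOrEdge d a A' B') : SquareOrEdge d a A B := by
  rcases h with h | ⟨i, j, k, l, hj, hl, h1, h2, h3, h4⟩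
  · exact Or.inl (by grind)
  · obtain ⟨p, q, hp, hq, hpq, hAp, hBq⟩ := exists_edge_ne_zero (by grind) hj hl h1 h2 h3 h4
    unfold SquareOrEdge IsEdge PairLE
    by_cases hqd : q = d - 1
    · exact Or.inl (by grind)
    · exact Or.inr ⟨p, q, 0, c, by grind⟩

lemma SquareOrEdge.of_x (had : a < d) (ha : 1 ≤ a) (hA0 : 1 ≤ A 0)
    (hBz : ∀ j, j < a → B j = 0)
    (hA : ∀ q, q = 0 ∨ (a ≤ q ∧ q < d - 1) → A' q = A q) (hB : ∀ q, B' q = B q)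
    (h : SquareOrEdge d a A' B') : SquareOrEdge d a A B := by
  rcases h with h | ⟨i, j, k, l, hj, hl, h1, h2, h3, h4⟩
  · exact Or.inl (by grind)
  · have hpos := And.intro h4.1 h4.2.1
    by_cases hjd : j = d - 1
    · exact Or.inl (by grind)
    by_cases hld : l = d - 1
    · exact Or.inl (by grind)
    · have hi : i = 0 ∨ (a ≤ i ∧ i < d - 1) := by unfold IsEdge at h1; grind
      have hk : k = 0 ∨ (a ≤ k ∧ k < d - 1) := by unfold IsEdge at h2; grind
      exact Or.inr ⟨i, j, k, l, hj, hl, h1, h2, h3.congr (hA _ hi) (hA _ hk),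
        h4.congr (hB _) (hB _)⟩

lemma SquareOrEdge.of_yxy {c i e : ℕ} (hc : c < a) (hi : 1 ≤ i) (hic : i ≤ c) (hae : a ≤ e)
    (hed : e < d) (hAi : 1 ≤ A i) (hBc : 1 ≤ B c) (hBe : 1 ≤ B e)
    (hA0 : A 0 = 0) (hBz : ∀ j, e < j → j < d → B j = 0)
    (hA : ∀ q, q ≤ e → A' q = A q) (hB : ∀ q, 1 ≤ q ∧ q < a ∨ e < q → B' q = B q)
    (h : SquareOrEdge d a A' B') : SquareOrEdge d a A B := by
  rcases h with h | ⟨i', j, k, l, hj, hl, h1, h2, h3, h4⟩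
  · exact absurd h.1 (by grind)
  · unfold SquareOrEdge IsEdge PairLE at *
    by_cases hia : a ≤ i'
    · exact Or.inr ⟨i', e, i, c, by grind⟩
    by_cases hka : a ≤ k
    · exact Or.inr ⟨k, e, i, c, by grind⟩
    · exact Or.inr ⟨i', j, k, l, by grind⟩

lemma SquareOrEdge.of_lower (hA0 : A 0 = 0) (hBz : ∀ j, a ≤ j → j < d → B j = 0)
    (hA : ∀ q, q < a → A' q = A q) (hB : ∀ q, 1 ≤ q → B' q = B q)
    (ha : 1 ≤ a) (h : SquareOrEdge d a A' B') : SquareOrEdge d a A B := by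
  rcases h with h | ⟨i', j, k, l, hj, hl, h1, h2, h3, h4⟩
  · exact absurd h.1 (by grind)
  · unfold SquareOrEdge IsEdge PairLE at *
    exact Or.inr ⟨i', j, k, l, by grind⟩

lemma SquareOrEdge.of_upper {c : ℕ} (hc : c < a) (hBz : ∀ j, c < j → j < a → B j = 0)
    (hAz : ∀ j, j ≤ c → A j = 0)
    (hA : ∀ q, q ≤ c ∨ a ≤ q → A' q = A q) (hB : ∀ q, c < q → B' q = B q)
    (h : SquareOrEdge d a A' B') : SquareOrEdge d a A B := by
  rcases h with h | ⟨i', j, k, l, hj, hl, h1, h2, h3, h4⟩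
  · exact absurd h.1 (by grind)
  · have hA1 := And.intro h3.1 h3.2.1
    have hB1 := And.intro h4.1 h4.2.1
    have hi : a ≤ i' ∧ c < j := by unfold IsEdge at h1; grind
    have hk : a ≤ k ∧ c < l := by unfold IsEdge at h2; grind
    exact Or.inr ⟨i', j, k, l, hj, hl, h1, h2,
      h3.congr (hA _ (Or.inr hi.1)) (hA _ (Or.inr hk.1)), h4.congr (hB _ hi.2) (hB _ hk.2)⟩

end Combinatorics

section Graph

variable {k : Type} [Field k] {d a N : ℕ}

/-- The exponent of `x_q` in a monomial. -/
noncomputable def xExp (m : Fin d ⊕ Fin d →₀ ℕ) (q : ℕ) : ℕ :=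
  if h : q < d then m (Sum.inl ⟨q, h⟩) else 0

/-- The exponent of `y_q` in a monomial. -/
noncomputable def yExp (m : Fin d ⊕ Fin d →₀ ℕ) (q : ℕ) : ℕ :=
  if h : q < d then m (Sum.inr ⟨q, h⟩) else 0

/-- Increase the value of `f` at `q` by one. -/
def bump (f : ℕ → ℕ) (q j : ℕ) : ℕ :=
  f j + if j = q then 1 else 0

lemma xExp_add_single_inl (m : Fin d ⊕ Fin d →₀ ℕ) {q : ℕ} (hq : q < d) :
    xExp (m + Finsupp.single (Sum.inl ⟨q, hq⟩) 1) = bump (xExp m) q := by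
  ext j
  by_cases hj : j < d <;>
    simp [xExp, bump, Finsupp.single_apply, hj, eq_comm]
  grind

lemma xExp_add_single_inr (m : Fin d ⊕ Fin d →₀ ℕ) (q : Fin d) :
    xExp (m + Finsupp.single (Sum.inr q) 1) = xExp m := by
  ext j
  simp [xExp]

lemma yExp_add_single_inr (m : Fin d ⊕ Fin d →₀ ℕ) {q : ℕ} (hq : q < d) :
    yExp (m + Finsupp.single (Sum.inr ⟨q, hq⟩) 1) = bump (yExp m) q := by
  ext j
  by_cases hj : j < d <;>
    simp [yExp, bump, Finsupp.single_apply, hj, eq_comm]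
  grind

lemma yExp_add_single_inl (m : Fin d ⊕ Fin d →₀ ℕ) (q : Fin d) :
    yExp (m + Finsupp.single (Sum.inl q) 1) = yExp m := by
  ext j
  simp [yExp]

lemma xExp_add (m n : Fin d ⊕ Fin d →₀ ℕ) (q : ℕ) : xExp (m + n) q = xExp m q + xExp n q := by
  by_cases hq : q < d <;> simp [xExp, hq]

lemma yExp_add (m n : Fin d ⊕ Fin d →₀ ℕ) (q : ℕ) : yExp (m + n) q = yExp m q + yExp n q := by
  by_cases hq : q < d <;> simp [yExp, hq]

lemma PairLE.mono {f g : ℕ → ℕ} {i j : ℕ} (h : PairLE f i j) (hfg : ∀ q, f q ≤ g q) :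
    PairLE g i j :=
  ⟨h.1.trans (hfg _), h.2.1.trans (hfg _), fun hij => (h.2.2 hij).trans (hfg _)⟩

lemma SquareOrEdge.mono {A B A' B' : ℕ → ℕ} (h : SquareOrEdge d a A B) (hA : ∀ q, A q ≤ A' q)
    (hB : ∀ q, B q ≤ B' q) : SquareOrEdge d a A' B' := by
  rcases h with h | ⟨i, j, k, l, hj, hl, h1, h2, h3, h4⟩
  · exact Or.inl ⟨h.1.trans (hA _), h.2.trans (hB _)⟩
  · exact Or.inr ⟨i, j, k, l, hj, hl, h1, h2, h3.mono hA, h4.mono hB⟩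

variable (d a) in
/-- The exponents of the monomials in `I(G_{d,a})^2 + (x_0 y_{d-1})`. -/
def GraphPred (m : Fin d ⊕ Fin d →₀ ℕ) : Prop :=
  SquareOrEdge d a (xExp m) (yExp m)

lemma GraphPred.monotone : Monotone (GraphPred d a) := by
  intro m n hmn h
  obtain ⟨c, rfl⟩ := exists_add_of_le hmn
  exact SquareOrEdge.mono h (fun q => by simp [xExp_add]) (fun q => by simp [yExp_add])

/-- The variables `x_q` with `q < p` and `y_q` with `B q`. -/
def varSet (d p : ℕ) (B : ℕ → Prop) : Set (Fin d ⊕ Fin d) :=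
  {v | Sum.elim (fun i : Fin d => (i : ℕ) < p) (fun j : Fin d => B j) v}

variable (k d a N) in
/-- The cohomological vanishing in degrees below `N` for the ideal
`((I(G_{d,a})^2 + (x_0 y_{d-1})) : u) + (x_q : q < p) + (y_q : B q)`, where `u` is the monomial
with exponents `ux` and `uy`. -/
def NodeVanish (p : ℕ) (B : ℕ → Prop) (ux uy : ℕ → ℕ) : Prop :=
  ∀ u : Fin d ⊕ Fin d →₀ ℕ, xExp u = ux → yExp u = uy →
    ExtVanishBelow (maxHomIdeal k _)
      (monIdeal k (NodePred (GraphPred d a) (varSet d p B) u)) N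

lemma NodeVanish.of_split_x {p : ℕ} {B : ℕ → Prop} {ux uy : ℕ → ℕ} (hp : p < d)
    (h₁ : NodeVanish k d a N p B (bump ux p) uy) (h₂ : NodeVanish k d a N (p + 1) B ux uy) :
    NodeVanish k d a N p B ux uy := by
  rintro u rfl rfl
  refine extVanishBelow_node_of_split GraphPred.monotone (Sum.inl ⟨p, hp⟩)
    (h₁ _ (xExp_add_single_inl _ _) (yExp_add_single_inl _ _)) ?_
  convert h₂ u rfl rfl using 3
  ext v
  rcases v with v | v <;> simp [varSet, Fin.ext_iff]
  omega

lemma NodeVanish.of_split_y {p q : ℕ} {B B' : ℕ → Prop} {ux uy : ℕ → ℕ} (hq : q < d)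
    (hB : ∀ j, B' j ↔ j = q ∨ B j)
    (h₁ : NodeVanish k d a N p B ux (bump uy q)) (h₂ : NodeVanish k d a N p B' ux uy) :
    NodeVanish k d a N p B ux uy := by
  rintro u rfl rfl
  refine extVanishBelow_node_of_split GraphPred.monotone (Sum.inr ⟨q, hq⟩)
    (h₁ _ (xExp_add_single_inr _ _) (yExp_add_single_inr _ _)) ?_
  convert h₂ u rfl rfl using 3
  ext v
  rcases v with v | v <;> simp [varSet, Fin.ext_iff, hB]

lemma NodeVanish.of_loop_y {p b s : ℕ} {B : ℕ → Prop} {ux uy : ℕ → ℕ} (hb : b ≤ d) (hs : s < b)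
    (hend : NodeVanish k d a N p (fun j => B j ∨ (s < j ∧ j < b)) ux uy)
    (hstep : ∀ c, s < c → c < b →
      NodeVanish k d a N p (fun j => B j ∨ (c < j ∧ j < b)) ux (bump uy c)) :
    NodeVanish k d a N p B ux uy := by
  have key : ∀ c, s ≤ c → c < b →
      NodeVanish k d a N p (fun j => B j ∨ (c < j ∧ j < b)) ux uy := by
    intro c hc
    induction c, hc using Nat.le_induction with
    | base => exact fun _ => hend
    | succ c hc ih =>
      intro hcb
      refine NodeVanish.of_split_y (hcb.trans_le hb) (fun j => ?_)
        (hstep (c + 1) (by omega) hcb) (ih (by omega))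
      grind
  convert key (b - 1) (by omega) (by omega) using 2 with j
  grind

lemma NodeVanish.of_loop_x {s t : ℕ} {B : ℕ → Prop} {ux uy : ℕ → ℕ} (hst : s ≤ t) (ht : t ≤ d)
    (hend : NodeVanish k d a N t B ux uy)
    (hstep : ∀ i, s ≤ i → i < t → NodeVanish k d a N i B (bump ux i) uy) :
    NodeVanish k d a N s B ux uy := by
  induction t, hst using Nat.le_induction with
  | base => exact hend
  | succ t hst ih =>
    exact ih (by omega) (.of_split_x ht (hstep t hst (by omega)) hend)
      fun i hi hit => hstep i hi (by omega)

lemma NodeVanish.of_leaf {p : ℕ} {B : ℕ → Prop} {ux uy : ℕ → ℕ} (isX : ℕ → Prop) (idx : ℕ → ℕ)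
    (hidx : ∀ n < N, idx n < d)
    (hinj : ∀ n < N, ∀ n' < N, idx n = idx n' → (isX n ↔ isX n') → n = n')
    (hx : ∀ n < N, isX n → p ≤ idx n) (hy : ∀ n < N, ¬ isX n → ¬ B (idx n))
    (h : ∀ n < N, ∀ A B' A' B'' : ℕ → ℕ, (∀ q < p, A q = ux q) → (∀ q, B q → B' q = uy q) →
      (∀ q, ux q ≤ A q) → (∀ q, uy q ≤ B' q) →
      (∀ q, A' q = A q ∨ isX n ∧ q = idx n) → (∀ q, B'' q = B' q ∨ ¬ isX n ∧ q = idx n) →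
      SquareOrEdge d a A' B'' → SquareOrEdge d a A B') :
    NodeVanish k d a N p B ux uy := by
  classical
  rintro u rfl rfl
  rcases Nat.eq_zero_or_pos N with rfl | hN
  · exact extVanishBelow_zero _ _
  have hd : 0 < d := (Nat.zero_le _).trans_lt (hidx 0 hN)
  let φ : ℕ → Fin d ⊕ Fin d := fun n =>
    if hn : idx n < d then if isX n then Sum.inl ⟨idx n, hn⟩ else Sum.inr ⟨idx n, hn⟩
    else Sum.inl ⟨0, hd⟩
  refine extVanishBelow_node_of_injOn GraphPred.monotone φ ?_ ?_ ?_
  · intro n hn n' hn' h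
    rw [Set.mem_Iio] at hn hn'
    refine hinj n hn n' hn' ?_ ?_
    · by_cases h1 : isX n <;> by_cases h2 : isX n' <;>
        simp_all [φ]
    · by_cases h1 : isX n <;> by_cases h2 : isX n' <;>
        simp [φ, h1, h2, hidx n hn, hidx n' hn'] at h ⊢
  · intro n hn
    by_cases h1 : isX n
    · simpa [φ, h1, varSet, hidx n hn] using hx n hn h1
    · simpa [φ, h1, varSet, hidx n hn] using hy n hn h1
  · intro n hn m hm
    refine h n hn _ _ _ _ ?_ ?_ ?_ ?_ ?_ ?_
    · intro q hq
      by_cases hqd : q < d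
      · have := hm (Sum.inl ⟨q, hqd⟩) hq
        simp [xExp, hqd, this]
      · simp [xExp, hqd]
    · intro q hq
      by_cases hqd : q < d
      · have := hm (Sum.inr ⟨q, hqd⟩) hq
        simp [yExp, hqd, this]
      · simp [yExp, hqd]
    · exact fun q => by simp [xExp_add]
    · exact fun q => by simp [yExp_add]
    · intro q
      by_cases h1 : isX n
      · simp only [φ, h1, hidx n hn, dif_pos, if_true, xExp_add_single_inl, bump]
        grind
      · simp only [φ, h1, hidx n hn, dif_pos, if_false, xExp_add_single_inr]
        grind
    · intro q
      by_cases h1 : isX n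
      · simp only [φ, h1, hidx n hn, dif_pos, if_true, yExp_add_single_inl]
        grind
      · simp only [φ, h1, hidx n hn, dif_pos, if_false, yExp_add_single_inr, bump]
        grind

end Graph

section Tree

variable {k : Type} [Field k] {d a N : ℕ} {B : ℕ → Prop} {uy : ℕ → ℕ}

lemma nodeVanish_of_two_x (hN : N ≤ d) :
    NodeVanish k d a N 0 B (bump (bump (fun _ => 0) 0) 0) uy := by
  refine .of_leaf (fun _ => True) id (by grind) (by grind) (by grind) (by grind) ?_
  intro n hn A B' A' B'' hA hBz hA' hB' h1 h2 h
  exact h.of_two_x (by grind [bump]) (by grind)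

lemma nodeVanish_of_xyy {c : ℕ} (had : a < d) (hN : N ≤ a) (hc : c < a)
    (hB : ∀ j, B j ↔ c < j ∧ j < a) (huy0 : 1 ≤ uy 0) (huyc : 1 ≤ uy c)
    (huy : ∀ j, c < j → uy j = 0) :
    NodeVanish k d a N 1 B (bump (fun _ => 0) 0) uy := by
  refine .of_leaf (fun n => c < n) id (by grind) (by grind) (by grind) (by grind) ?_
  intro n hn A B' A' B'' hA hBz hA' hB' h1 h2 h
  exact h.of_xyy (c := c) had hc (by grind [bump]) (by grind) (by grind) (by grind)
    (by grind) (by grind)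

lemma nodeVanish_of_xyx {c i : ℕ} (had : a < d) (hN : N ≤ d - a + 1) (hc : c < a) (hi : 1 ≤ i)
    (hic : i ≤ c) :
    NodeVanish k d a N i B (bump (bump (fun _ => 0) 0) i) (bump (fun _ => 0) c) := by
  refine .of_leaf (fun _ => True) (fun n => i + n) (by grind) (by grind) (by grind) (by grind) ?_
  intro n hn A B' A' B'' hA hBz hA' hB' h1 h2 h
  exact h.of_xyx (c := c) (i := i) had hc hi hic (by grind [bump]) (by grind [bump])
    (by grind [bump]) (by grind)

lemma nodeVanish_of_xy {c : ℕ} (had : a < d) (hN : N ≤ a) (hc : c < a) (hc1 : 1 ≤ c)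
    (hB : ∀ j, B j ↔ j = 0 ∨ (c < j ∧ j < a)) :
    NodeVanish k d a N (c + 1) B (bump (fun _ => 0) 0) (bump (fun _ => 0) c) := by
  refine .of_leaf (fun n => n = 0 ∨ c < n) (fun n => if n = 0 then d - 1 else n)
    (by grind) (by grind) (by grind) (by grind) ?_
  intro n hn A B' A' B'' hA hBz hA' hB' h1 h2 h
  exact h.of_xy (c := c) had hc hc1 (by grind [bump]) (by grind [bump]) (by grind [bump])
    (by grind [bump]) (by grind) (by grind)

lemma nodeVanish_of_x (had : a < d) (hN : N ≤ a) (hB : ∀ j, B j ↔ j < a) :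
    NodeVanish k d a N 1 B (bump (fun _ => 0) 0) (fun _ => 0) := by
  refine .of_leaf (fun _ => True) (fun n => if n = 0 then d - 1 else n)
    (by grind) (by grind) (by grind) (by grind) ?_
  intro n hn A B' A' B'' hA hBz hA' hB' h1 h2 h
  exact h.of_x had (by grind) (by grind [bump]) (by grind) (by grind) (by grind)

lemma nodeVanish_of_yxy {c i e : ℕ} (hN : N ≤ d - a + 1) (hc : c < a) (hi : 1 ≤ i)
    (hic : i ≤ c) (hae : a ≤ e) (hed : e < d)
    (hB : ∀ j, B j ↔ (c < j ∧ j < a) ∨ (e < j ∧ j < d)) :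
    NodeVanish k d a N i B (bump (fun _ => 0) i) (bump (bump (fun _ => 0) c) e) := by
  refine .of_leaf (fun n => n ≠ 0 ∧ e < a + n - 1) (fun n => if n = 0 then 0 else a + n - 1)
    (by grind) (by grind) (by grind) (by grind) ?_
  intro n hn A B' A' B'' hA hBz hA' hB' h1 h2 h
  exact h.of_yxy (c := c) (i := i) (e := e) hc hi hic hae hed (by grind [bump]) (by grind [bump])
    (by grind [bump]) (by grind [bump]) (by grind [bump]) (by grind) (by grind)

lemma nodeVanish_of_lower {c i : ℕ} (hN : N ≤ d - a + 1) (hc : c < a) (hi : 1 ≤ i)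
    (hic : i ≤ c) (had : a < d) (hB : ∀ j, B j ↔ (c < j ∧ j < a) ∨ (a ≤ j ∧ j < d)) :
    NodeVanish k d a N i B (bump (fun _ => 0) i) (bump (fun _ => 0) c) := by
  refine .of_leaf (fun n => n ≠ 0) (fun n => if n = 0 then 0 else a + n - 1)
    (by grind) (by grind) (by grind) (by grind) ?_
  intro n hn A B' A' B'' hA hBz hA' hB' h1 h2 h
  exact h.of_lower (by grind [bump]) (by grind [bump]) (by grind) (by grind) (by grind)

lemma nodeVanish_of_upper {c : ℕ} (had : a < d) (hN : N ≤ a) (hc : c < a)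
    (hB : ∀ j, B j ↔ c < j ∧ j < a) (huy : ∀ j, c < j → uy j = 0) :
    NodeVanish k d a N (c + 1) B (fun _ => 0) uy := by
  refine .of_leaf (fun n => c < n) id (by grind) (by grind) (by grind) (by grind) ?_
  intro n hn A B' A' B'' hA hBz hA' hB' h1 h2 h
  exact h.of_upper (c := c) hc (by grind) (by grind) (by grind) (by grind)

lemma nodeVanish_x_zero (had : a < d) (ha : 1 ≤ a) (hN : N ≤ a) (hN' : N ≤ d - a + 1) :
    NodeVanish k d a N 0 (fun _ => False) (bump (fun _ => 0) 0) (fun _ => 0) := by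
  refine .of_split_x (by omega) (nodeVanish_of_two_x (by omega))
    (.of_split_y (q := 0) (B' := fun j => j = 0) (by omega) (by grind) ?_ ?_)
  · refine .of_loop_y had.le ha ?_ fun c hc hca => ?_
    · exact nodeVanish_of_xyy (c := 0) had hN ha (by grind) (by grind [bump]) (by grind [bump])
        (by grind [bump])
    · exact nodeVanish_of_xyy (c := c) had hN hca (by grind) (by grind [bump]) (by grind [bump])
        (by grind [bump])
  · refine .of_loop_y had.le ha ?_ fun c hc hca => ?_
    · exact nodeVanish_of_x had hN (by grind)
    · refine .of_loop_x (t := c + 1) (by omega) (by omega) ?_ fun i hi hic => ?_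
      · exact nodeVanish_of_xy had hN hca hc (by grind)
      · exact nodeVanish_of_xyx had hN' hca hi (by omega)

lemma nodeVanish_one (had : a < d) (ha : 1 ≤ a) (hN : N ≤ a) (hN' : N ≤ d - a + 1) :
    NodeVanish k d a N 1 (fun _ => False) (fun _ => 0) (fun _ => 0) := by
  refine .of_loop_y had.le ha ?_ fun c hc hca => ?_
  · exact nodeVanish_of_upper had hN ha (by grind) (by grind)
  refine .of_loop_x (t := c + 1) (by omega) (by omega) ?_ fun i hi hic => ?_
  · exact nodeVanish_of_upper had hN hca (by grind) (by grind [bump])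
  refine .of_loop_y (s := a - 1) le_rfl (by omega) ?_ fun e he hed => ?_
  · exact nodeVanish_of_lower hN' hca hi (by omega) had (by grind)
  · exact nodeVanish_of_yxy hN' hca hi (by omega) (by omega) hed (by grind)

lemma nodeVanish_root (had : a < d) (ha : 1 ≤ a) (hN : N ≤ a) (hN' : N ≤ d - a + 1) :
    NodeVanish k d a N 0 (fun _ => False) (fun _ => 0) (fun _ => 0) :=
  .of_split_x (by omega) (nodeVanish_x_zero had ha hN hN') (nodeVanish_one had ha hN hN')

lemma extVanishBelow_graphPred (had : a < d) (ha : 1 ≤ a) (hN : N ≤ a) (hN' : N ≤ d - a + 1) :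
    ExtVanishBelow (maxHomIdeal k _) (monIdeal k (GraphPred d a)) N := by
  convert nodeVanish_root had ha hN hN' 0 (by ext; simp [xExp]) (by ext; simp [yExp]) using 2
  ext m
  simp [NodePred, varSet]

end Tree

section EdgeIdeal

variable (k : Type) [Field k] {d a : ℕ}

variable (d a) in
/-- The generators of `I(G_{d,a})`. -/
def edgeMonomials : Set (MvPolynomial (Fin d ⊕ Fin d) k) :=
  {p | ∃ i j : Fin d, IsEdge a i j ∧ p = X (Sum.inl i) * X (Sum.inr j)}

/-- The exponent of `x_i y_j x_{i'} y_{j'}`. -/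
noncomputable def edgePairExp (i j i' j' : Fin d) : Fin d ⊕ Fin d →₀ ℕ :=
  Finsupp.single (Sum.inl i) 1 + Finsupp.single (Sum.inr j) 1 +
    (Finsupp.single (Sum.inl i') 1 + Finsupp.single (Sum.inr j') 1)

lemma X_mul_X_mul_X_mul_X (i j i' j' : Fin d) :
    (X (Sum.inl i) * X (Sum.inr j) * (X (Sum.inl i') * X (Sum.inr j')) :
      MvPolynomial (Fin d ⊕ Fin d) k) = monomial (edgePairExp i j i' j') 1 := by
  simp [X, monomial_mul, edgePairExp]

lemma graphPred_edgePairExp {i j i' j' : Fin d} (h : IsEdge a i j) (h' : IsEdge a i' j') :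
    GraphPred d a (edgePairExp i j i' j') := by
  refine Or.inr ⟨i, j, i', j', j.2, j'.2, h, h', ?_, ?_⟩
  · simp [PairLE, xExp, edgePairExp, Finsupp.single_apply, Fin.ext_iff]
    grind
  · simp [PairLE, yExp, edgePairExp, Finsupp.single_apply, Fin.ext_iff]
    grind

lemma edgePairExp_le {i j i' j' : Fin d} {m : Fin d ⊕ Fin d →₀ ℕ}
    (hx : PairLE (xExp m) i i') (hy : PairLE (yExp m) j j') : edgePairExp i j i' j' ≤ m := by
  intro v
  simp only [PairLE, xExp, yExp, Fin.is_lt, dif_pos, Fin.eta, ← Fin.ext_iff] at hx hy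
  rcases v with v | v <;> simp [edgePairExp, Finsupp.single_apply]
  · grind
  · grind

lemma monomial_mem_of_le {V : Type} {J : Ideal (MvPolynomial V k)} {m n : V →₀ ℕ} (hnm : n ≤ m)
    (h : monomial n 1 ∈ J) : monomial m 1 ∈ J := by
  refine Ideal.mem_of_dvd _ ?_ h
  exact monomial_dvd_monomial.2 ⟨Or.inr hnm, one_dvd _⟩

lemma span_edgeMonomials_sq_sup (hd : 0 < d) :
    Ideal.span (edgeMonomials k d a) ^ 2 ⊔
      Ideal.span {(X (Sum.inl (⟨0, hd⟩ : Fin d)) *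
        X (Sum.inr (⟨d - 1, Nat.sub_one_lt_of_lt hd⟩ : Fin d)) :
          MvPolynomial (Fin d ⊕ Fin d) k)} = monIdeal k (GraphPred d a) := by
  have hX : (X (Sum.inl (⟨0, hd⟩ : Fin d)) *
      X (Sum.inr (⟨d - 1, Nat.sub_one_lt_of_lt hd⟩ : Fin d)) : MvPolynomial (Fin d ⊕ Fin d) k) =
      monomial (Finsupp.single (Sum.inl ⟨0, hd⟩) 1 +
        Finsupp.single (Sum.inr ⟨d - 1, Nat.sub_one_lt_of_lt hd⟩) 1) 1 := by
    simp [X, monomial_mul]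
  rw [hX, pow_two, Ideal.span_mul_span']
  apply le_antisymm
  · refine sup_le (Ideal.span_le.2 ?_) ((Ideal.span_singleton_le_iff_mem _).2 ?_)
    · rintro _ ⟨_, ⟨i, j, hij, rfl⟩, _, ⟨i', j', hij', rfl⟩, rfl⟩
      simp only [X_mul_X_mul_X_mul_X]
      exact monomial_mem_monIdeal (graphPred_edgePairExp hij hij')
    · exact monomial_mem_monIdeal (Or.inl (by simp [xExp, yExp, hd]))
  · refine Ideal.span_le.2 ?_
    rintro _ ⟨m, ⟨hx, hy⟩ | ⟨i, j, i', j', hj, hj', hij, hij', hx, hy⟩, rfl⟩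
    · refine monomial_mem_of_le k ?_
        (Ideal.mem_sup_right (Ideal.mem_span_singleton_self _))
      intro v
      simp only [xExp, yExp, hd, Nat.sub_one_lt_of_lt hd, dif_pos] at hx hy
      rcases v with v | v <;> simp [Finsupp.single_apply] <;> grind
    · have hi : i < d := by
        by_contra h
        simp [PairLE, xExp, h] at hx
      have hi' : i' < d := by
        by_contra h
        simp [PairLE, xExp, h] at hx
      refine monomial_mem_of_le k (edgePairExp_le (i := ⟨i, hi⟩) (j := ⟨j, hj⟩) (i' := ⟨i', hi'⟩)
        (j' := ⟨j', hj'⟩) hx hy) (Ideal.mem_sup_left ?_)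
      rw [← X_mul_X_mul_X_mul_X]
      exact Ideal.subset_span (Set.mul_mem_mul ⟨_, _, hij, rfl⟩ ⟨_, _, hij', rfl⟩)

lemma monIdeal_graphPred_le : monIdeal k (GraphPred d a) ≤ maxHomIdeal k _ := by
  rw [maxHomIdeal_eq_ker]
  refine Ideal.span_le.2 ?_
  rintro _ ⟨m, hm, rfl⟩
  rw [SetLike.mem_coe, RingHom.mem_ker, constantCoeff_monomial, if_neg]
  rintro rfl
  rcases hm with h | ⟨i, j, i', j', -, -, -, -, h, -⟩
  · simp [xExp] at h
  · simp [PairLE, xExp] at h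

end EdgeIdeal

/-- Here the ideal `I` is the edge ideal
`I(G_{d,a}) = x_1(y_1, …, y_d) + (x_i y_j : 2 ≤ i ≤ j ≤ a) + (x_i y_j : a+1 ≤ i ≤ j ≤ d)`
of the bipartite graph `G_{d,a}`, with `x_i = X (inl i)`, `y_i = X (inr i)` and `1`-based
indices translated to `0`-based `Fin d` indices.
Then `depth S/(I(G_{d,a})^2 + (x_1 y_d)) ≥ min (a, d - a + 1)`. -/
theorem depth_square_plus_edge_two_drops_graph (k : Type) [Field k] (d a : ℕ)
    (hd : 5 ≤ d) (ha2 : 2 ≤ a) (had : a ≤ d - 1)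
    (I : Ideal (MvPolynomial (Fin d ⊕ Fin d) k))
    (hI : I = Ideal.span
      ({p | ∃ i : Fin d, p = X (Sum.inl (⟨0, by omega⟩ : Fin d)) * X (Sum.inr i)} ∪
       {p | ∃ i jm : Fin d, 1 ≤ (i : ℕ) ∧ i ≤ jm ∧ (jm : ℕ) < a ∧
          p = X (Sum.inl i) * X (Sum.inr jm)} ∪
       {p | ∃ i jm : Fin d, a ≤ (i : ℕ) ∧ i ≤ jm ∧
          p = X (Sum.inl i) * X (Sum.inr jm)})) :
    min a (d - a + 1) ≤
      depthQuot k (I ^ 2 ⊔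
        Ideal.span {(X (Sum.inl (⟨0, by omega⟩ : Fin d)) *
          X (Sum.inr (⟨d - 1, by omega⟩ : Fin d)) : MvPolynomial (Fin d ⊕ Fin d) k)}) := by
  have hI' : I = Ideal.span (edgeMonomials k d a) := by
    rw [hI]
    congr 1
    ext p
    constructor
    · rintro ((⟨j, rfl⟩ | ⟨i, j, h1, h2, h3, rfl⟩) | ⟨i, j, h1, h2, rfl⟩)
      · exact ⟨_, j, Or.inl rfl, rfl⟩
      · exact ⟨i, j, Or.inr (Or.inl ⟨h1, h2, h3⟩), rfl⟩
      · exact ⟨i, j, Or.inr (Or.inr ⟨h1, h2⟩), rfl⟩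
    · rintro ⟨i, j, h | ⟨h1, h2, h3⟩ | ⟨h1, h2⟩, rfl⟩
      · exact Or.inl (Or.inl ⟨j, by rw [show i = ⟨0, by omega⟩ from Fin.ext h]⟩)
      · exact Or.inl (Or.inr ⟨i, j, h1, h2, h3, rfl⟩)
      · exact Or.inr ⟨i, j, h1, h2, rfl⟩
  rw [hI', span_edgeMonomials_sq_sup k (by omega)]
  exact le_depthQuot (monIdeal_graphPred_le k)
    (extVanishBelow_graphPred (by omega) (by omega) (min_le_left _ _) (min_le_right _ _))
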